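/- arXiv:0812.3961 — 3 statements merged into one kernel-verified Lean document; each statement's English description precedes it below -/
import Mathlib

section
/- Let A, B : ℤ × ℤ → ℂ be matrices that decay rapidly off-diagonal, i.e. for every r ∈ ℕ there exist constants c_{A,r}, c_{B,r} such that |A_{ij}| ≤ c_{A,r}·(1 + |i − j|)^{−r} and |B_{ij}| ≤ c_{B,r}·(1 + |i − j|)^{−r} for all i, j ∈ ℤ. Then for all i, k ∈ ℤ the series Σ_{j∈ℤ} A_{ij} B_{jk} converges absolutely, and the product matrix (AB)_{ik} = Σ_{j∈ℤ} A_{ij} B_{jk} also decays rapidly off-diagonal: for every r ∈ ℕ there exists a constant C_r such that |(AB)_{ik}| ≤ C_r·(1 + |i − k|)^{−r} for all i, k ∈ ℤ. -/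
theorem aux_summable : Summable fun n : ℤ => (((1 + |n| : ℤ) : ℝ) ^ 2)⁻¹ := by
  have h1 : Summable fun n : ℤ => 1 / (n : ℝ) ^ 2 :=
    Real.summable_one_div_int_pow.mpr (by norm_num)
  have h2 : Summable fun n : ℤ => if n = 0 then (1 : ℝ) else 0 :=
    (hasSum_ite_eq (0 : ℤ) (1 : ℝ)).summable
  refine Summable.of_nonneg_of_le (fun n => by positivity) (fun n => ?_) (h1.add h2)
  by_cases hn : n = 0
  · subst hn
    simp
  · have hp : 0 < |(n : ℝ)| := by
      rw [abs_pos]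
      exact_mod_cast hn
    simp only [hn, if_false, add_zero, one_div]
    rw [← sq_abs (n : ℝ)]
    push_cast
    gcongr
    linarith

theorem aux_w_pos (n : ℤ) : (0 : ℝ) < ((1 + |n| : ℤ) : ℝ) := by
  push_cast
  positivity

theorem aux_w (i j k : ℤ) : ((1 + |i - k| : ℤ) : ℝ) ≤
    ((1 + |i - j| : ℤ) : ℝ) * ((1 + |j - k| : ℤ) : ℝ) := by
  have h : 1 + |i - k| ≤ (1 + |i - j|) * (1 + |j - k|) := by
    nlinarith [abs_sub_le i j k, mul_nonneg (abs_nonneg (i - j)) (abs_nonneg (j - k))]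
  exact_mod_cast h

theorem aux_bound (A B : ℤ → ℤ → ℂ) (r : ℕ) (a b : ℝ)
    (hA : ∀ i j : ℤ, ‖A i j‖ ≤ a * (((1 + |i - j| : ℤ) : ℝ) ^ (r + 2))⁻¹)
    (hB : ∀ i j : ℤ, ‖B i j‖ ≤ b * (((1 + |i - j| : ℤ) : ℝ) ^ r)⁻¹) (i j k : ℤ) :
    ‖A i j * B j k‖ ≤ (a * b * (((1 + |i - k| : ℤ) : ℝ) ^ r)⁻¹) *
      (((1 + |i - j| : ℤ) : ℝ) ^ 2)⁻¹ := by
  have ha : 0 ≤ a := by simpa using (norm_nonneg _).trans (hA 0 0)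
  have hb : 0 ≤ b := by simpa using (norm_nonneg _).trans (hB 0 0)
  have hw := aux_w i j k
  have p1 := aux_w_pos (i - j)
  have p2 := aux_w_pos (j - k)
  have p3 := aux_w_pos (i - k)
  have hA' := hA i j
  have hB' := hB j k
  generalize ((1 + |i - j| : ℤ) : ℝ) = x at *
  generalize ((1 + |j - k| : ℤ) : ℝ) = y at *
  generalize ((1 + |i - k| : ℤ) : ℝ) = z at *
  rw [norm_mul]
  calc ‖A i j‖ * ‖B j k‖ ≤ (a * (x ^ (r + 2))⁻¹) * (b * (y ^ r)⁻¹) := by gcongr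
    _ = a * b * ((x * y) ^ r)⁻¹ * (x ^ 2)⁻¹ := by
      rw [mul_pow, pow_add, mul_inv, mul_inv]
      ring
    _ ≤ _ := by gcongr

/-- The product of two matrices with rapid off-diagonal decay is
well defined (the defining series converge absolutely) and again has rapid
off-diagonal decay. Here `⟨k⟩ = 1 + |k|`. -/
theorem rapid_offdiagonal_decay_mul (A B : ℤ → ℤ → ℂ)
    (hA : ∀ r : ℕ, ∃ c : ℝ, ∀ i j : ℤ,
      ‖A i j‖ ≤ c * (((1 + |i - j| : ℤ) : ℝ) ^ r)⁻¹)
    (hB : ∀ r : ℕ, ∃ c : ℝ, ∀ i j : ℤ,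
      ‖B i j‖ ≤ c * (((1 + |i - j| : ℤ) : ℝ) ^ r)⁻¹) :
    (∀ i k : ℤ, Summable fun j : ℤ => ‖A i j * B j k‖) ∧
    ∀ r : ℕ, ∃ C : ℝ, ∀ i k : ℤ,
      ‖∑' j : ℤ, A i j * B j k‖ ≤ C * (((1 + |i - k| : ℤ) : ℝ) ^ r)⁻¹ := by
  have hs : ∀ i : ℤ, Summable fun j : ℤ => (((1 + |i - j| : ℤ) : ℝ) ^ 2)⁻¹ := fun i =>
    (Equiv.subLeft i).summable_iff.mpr aux_summable
  have ht : ∀ i : ℤ, ∑' j : ℤ, (((1 + |i - j| : ℤ) : ℝ) ^ 2)⁻¹ =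
      ∑' n : ℤ, (((1 + |n| : ℤ) : ℝ) ^ 2)⁻¹ := fun i =>
    (Equiv.subLeft i).tsum_eq (fun n : ℤ => (((1 + |n| : ℤ) : ℝ) ^ 2)⁻¹)
  constructor
  · intro i k
    obtain ⟨a, ha⟩ := hA (0 + 2)
    obtain ⟨b, hb⟩ := hB 0
    exact Summable.of_nonneg_of_le (fun j => norm_nonneg _)
      (fun j => aux_bound A B 0 a b ha hb i j k) ((hs i).mul_left _)
  · intro r
    obtain ⟨a, ha⟩ := hA (r + 2)
    obtain ⟨b, hb⟩ := hB r
    refine ⟨a * b * ∑' n : ℤ, (((1 + |n| : ℤ) : ℝ) ^ 2)⁻¹, fun i k => ?_⟩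
    have h := tsum_of_norm_bounded ((hs i).mul_left _).hasSum
      (fun j => aux_bound A B r a b ha hb i j k)
    rw [tsum_mul_left, ht i] at h
    refine h.trans (le_of_eq ?_)
    ring
end

section
/- Let p, q, r, s ∈ ℕ with p + q = r + s and let a, b, c, d ∈ ℂ. Consider the polynomial function P(z₁, z₂) = (a z₁ + c z₂)^r · (b z₁ + d z₂)^s of two complex variables. Then the iterated derivative (∂/∂z₁)^p (∂/∂z₂)^q P is a constant function, equal at every point to Σ_i [p!·q!·r!·s! / (i!·(r−i)!·(p−i)!·(q−r+i)!)] · a^i · b^{p−i} · c^{r−i} · d^{q−r+i}, where the sum ranges over all integers i with 0 ≤ i ≤ min(p, r) and q − r + i ≥ 0. -/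
/-- Partial complex derivative in the first variable of `f : ℂ → ℂ → ℂ`. -/
noncomputable def pd1 (f : ℂ → ℂ → ℂ) : ℂ → ℂ → ℂ :=
  fun z₁ z₂ => deriv (fun w => f w z₂) z₁

/-- Partial complex derivative in the second variable of `f : ℂ → ℂ → ℂ`. -/
noncomputable def pd2 (f : ℂ → ℂ → ℂ) : ℂ → ℂ → ℂ :=
  fun z₁ z₂ => deriv (fun w => f z₁ w) z₂

theorem aux_pd2 {ι : Type} (S : Finset ι) (m n : ι → ℕ) (C : ι → ℂ) (q : ℕ) :
    pd2^[q] (fun w₁ w₂ => ∑ x ∈ S, C x * w₁ ^ m x * w₂ ^ n x) =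
      fun w₁ w₂ => ∑ x ∈ S, (C x * ((n x).descFactorial q : ℂ)) * w₁ ^ m x * w₂ ^ (n x - q) := by
  induction q with
  | zero => simp
  | succ q ih =>
    rw [Function.iterate_succ_apply', ih]
    funext w₁ w₂
    unfold pd2
    rw [deriv_fun_sum (fun i _ => by fun_prop)]
    refine Finset.sum_congr rfl fun x _ => ?_
    rw [deriv_const_mul_field, deriv_pow_field, Nat.descFactorial_succ, Nat.sub_sub]
    push_cast
    ring

theorem aux_pd1 {ι : Type} (S : Finset ι) (m n : ι → ℕ) (C : ι → ℂ) (p : ℕ) :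
    pd1^[p] (fun w₁ w₂ => ∑ x ∈ S, C x * w₁ ^ m x * w₂ ^ n x) =
      fun w₁ w₂ => ∑ x ∈ S, (C x * ((m x).descFactorial p : ℂ)) * w₁ ^ (m x - p) * w₂ ^ n x := by
  induction p with
  | zero => simp
  | succ q ih =>
    rw [Function.iterate_succ_apply', ih]
    funext w₁ w₂
    unfold pd1
    rw [deriv_fun_sum (fun i _ => by fun_prop)]
    refine Finset.sum_congr rfl fun x _ => ?_
    rw [deriv_mul_const_field, deriv_const_mul_field, deriv_pow_field, Nat.descFactorial_succ,
      Nat.sub_sub]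
    push_cast
    ring

theorem aux_expand (r s : ℕ) (a b c d : ℂ) :
    (fun w₁ w₂ : ℂ => (a * w₁ + c * w₂) ^ r * (b * w₁ + d * w₂) ^ s) =
    fun w₁ w₂ => ∑ x ∈ Finset.range (r + 1) ×ˢ Finset.range (s + 1),
      ((r.choose x.1 : ℂ) * (s.choose x.2 : ℂ) * a ^ x.1 * c ^ (r - x.1) * b ^ x.2 *
        d ^ (s - x.2)) * w₁ ^ (x.1 + x.2) * w₂ ^ ((r - x.1) + (s - x.2)) := by
  funext w₁ w₂
  rw [add_pow, add_pow, Finset.sum_mul_sum, ← Finset.sum_product']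
  refine Finset.sum_congr rfl fun x _ => ?_
  simp only [mul_pow, pow_add]
  ring

/-- For `p + q = r + s`, the iterated derivative
`(∂/∂z₁)^p (∂/∂z₂)^q` of `P(z₁,z₂) = (a z₁ + c z₂)^r (b z₁ + d z₂)^s` is the
constant function
`∑_i p! q! r! s! / (i! (r-i)! (p-i)! (q-r+i)!) · a^i b^{p-i} c^{r-i} d^{q-r+i}`,
summed over integers `i` with `0 ≤ i ≤ min p r` and `q - r + i ≥ 0`. -/
theorem iterated_deriv_rep_polynomial (p q r s : ℕ) (h : p + q = r + s)
    (a b c d : ℂ) :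
    ∀ z₁ z₂ : ℂ,
      (pd1^[p] (pd2^[q]
          (fun w₁ w₂ => (a * w₁ + c * w₂) ^ r * (b * w₁ + d * w₂) ^ s))) z₁ z₂ =
        ∑ i ∈ (Finset.range (min p r + 1)).filter (fun i => r ≤ q + i),
          (((p.factorial * q.factorial * r.factorial * s.factorial : ℕ) : ℂ) /
              ((i.factorial * (r - i).factorial * (p - i).factorial *
                (q + i - r).factorial : ℕ) : ℂ)) *
            a ^ i * b ^ (p - i) * c ^ (r - i) * d ^ (q + i - r) := by
  intro z₁ z₂
  rw [aux_expand, aux_pd2, aux_pd1]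
  dsimp only
  symm
  apply Finset.sum_of_injOn (fun i => (i, p - i))
  · intro i _ j _ hij
    exact (Prod.ext_iff.mp hij).1
  · intro i hi
    simp only [Finset.coe_filter, Finset.mem_range, Set.mem_setOf_eq] at hi
    simp only [Finset.coe_product, Set.mem_prod, Finset.mem_coe, Finset.mem_range]
    omega
  · rintro ⟨i, j⟩ hx hn
    simp only [Finset.mem_product, Finset.mem_range] at hx
    have hne : i + j ≠ p := by
      intro hp
      apply hn
      refine ⟨i, ?_, ?_⟩
      · simp only [Finset.coe_filter, Finset.mem_range, Set.mem_setOf_eq]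
        omega
      · ext <;> simp
        omega
    rcases lt_or_gt_of_ne hne with h1 | h1
    · have : (i + j).descFactorial p = 0 := Nat.descFactorial_eq_zero_iff_lt.mpr h1
      simp [this]
    · have : ((r - i) + (s - j)).descFactorial q = 0 :=
        Nat.descFactorial_eq_zero_iff_lt.mpr (by omega)
      simp [this]
  · intro i hi
    simp only [Finset.mem_filter, Finset.mem_range] at hi
    have e1 : i + (p - i) = p := by omega
    have e2 : (r - i) + (s - (p - i)) = q := by omega
    have e3 : s - (p - i) = q + i - r := by omega
    simp only [e1, e2, Nat.descFactorial_self, Nat.sub_self, pow_zero, mul_one]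
    rw [Nat.cast_choose ℂ (show i ≤ r by omega), Nat.cast_choose ℂ (show p - i ≤ s by omega), e3]
    push_cast
    have f1 : (i.factorial : ℂ) ≠ 0 := by exact_mod_cast i.factorial_ne_zero
    have f2 : ((r - i).factorial : ℂ) ≠ 0 := by exact_mod_cast (r - i).factorial_ne_zero
    have f3 : ((p - i).factorial : ℂ) ≠ 0 := by exact_mod_cast (p - i).factorial_ne_zero
    have f4 : ((q + i - r).factorial : ℂ) ≠ 0 := by exact_mod_cast (q + i - r).factorial_ne_zero
    field_simp
end

section
/- For p, q, r, s ∈ ℕ with p + q = r + s and a, b, c, d ∈ ℂ, define F_{p,q,r,s}(a,b,c,d) = √(p!·q!·r!·s!) · Σ_i a^i b^{p−i} c^{r−i} d^{q−r+i} / (i!·(r−i)!·(p−i)!·(q−r+i)!), the sum over all integers i with 0 ≤ i ≤ min(p, r) and q − r + i ≥ 0. Then for all p, q, r, s ∈ ℕ with p + q = r + s and all a, b, c, d ∈ ℂ satisfying ad − bc = 1: a · F_{p,q,r,s}(a,b,c,d) = (√((p+1)(r+1)) / (p+q+1)) · F_{p+1,q,r+1,s}(a,b,c,d) + (√(q·s)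 / (p+q+1)) · F_{p,q−1,r,s−1}(a,b,c,d), where in the last term, if q = 0 or s = 0, the coefficient √(q·s) vanishes and the term is interpreted as 0. -/
/-- The matrix element `F_{p,q,r,s}(a,b,c,d) = √(p! q! r! s!) ·
∑_i a^i b^{p-i} c^{r-i} d^{q-r+i} / (i! (r-i)! (p-i)! (q-r+i)!)`, the sum over
integers `i` with `0 ≤ i ≤ min p r` and `q - r + i ≥ 0`. -/
noncomputable def Felt (p q r s : ℕ) (a b c d : ℂ) : ℂ :=
  ((Real.sqrt ((p.factorial * q.factorial * r.factorial * s.factorial : ℕ)) : ℝ) : ℂ) *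
    ∑ i ∈ (Finset.range (min p r + 1)).filter (fun i => r ≤ q + i),
      a ^ i * b ^ (p - i) * c ^ (r - i) * d ^ (q + i - r) /
        ((i.factorial * (r - i).factorial * (p - i).factorial *
          (q + i - r).factorial : ℕ) : ℂ)

/-- Divided power, extended by zero to negative exponents. -/
noncomputable def dpw (x : ℂ) (n : ℤ) : ℂ :=
  if 0 ≤ n then x ^ n.toNat / (n.toNat.factorial : ℂ) else 0

lemma dpw_nat (x : ℂ) (n : ℕ) : dpw x (n : ℤ) = x ^ n / (n.factorial : ℂ) := by
  simp [dpw]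

lemma dpw_neg (x : ℂ) (n : ℤ) (h : n < 0) : dpw x n = 0 := by
  simp [dpw, h]

lemma mul_dpw (x : ℂ) (n m : ℤ) (h : m = n + 1) : x * dpw x n = (m : ℂ) * dpw x m := by
  subst h
  rcases lt_or_ge n 0 with hn | hn
  · rw [dpw_neg x n hn]
    rcases eq_or_ne n (-1) with h1 | h1
    · subst h1; simp
    · rw [dpw_neg x (n + 1) (by omega)]; simp
  · lift n to ℕ using hn
    have : ((n : ℤ) + 1) = ((n + 1 : ℕ) : ℤ) := by push_cast; rfl
    rw [this, dpw_nat, dpw_nat, Nat.factorial_succ]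
    have h1 : (n.factorial : ℂ) ≠ 0 := by exact_mod_cast n.factorial_ne_zero
    have h2 : ((n : ℂ) + 1) ≠ 0 := by exact_mod_cast n.succ_ne_zero
    push_cast
    field_simp
    ring

/-- The term of the sum. -/
noncomputable def trm (p q r : ℤ) (a b c d : ℂ) (i : ℕ) : ℂ :=
  dpw a i * dpw b (p - i) * dpw c (r - i) * dpw d (q + i - r)

lemma sum_bridge (p q r M : ℕ) (hM : p < M) (a b c d : ℂ) :
    ∑ i ∈ (Finset.range (min p r + 1)).filter (fun i => r ≤ q + i),
      a ^ i * b ^ (p - i) * c ^ (r - i) * d ^ (q + i - r) /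
        ((i.factorial * (r - i).factorial * (p - i).factorial *
          (q + i - r).factorial : ℕ) : ℂ) = ∑ i ∈ Finset.range M, trm p q r a b c d i := by
  rw [← Finset.sum_subset (s₁ := (Finset.range (min p r + 1)).filter (fun i => r ≤ q + i))
    (s₂ := Finset.range M) (f := trm p q r a b c d)]
  · apply Finset.sum_congr rfl
    intro i hi
    simp only [Finset.mem_filter, Finset.mem_range] at hi
    have e1 : ((p : ℤ) - i) = ((p - i : ℕ) : ℤ) := by omega
    have e2 : ((r : ℤ) - i) = ((r - i : ℕ) : ℤ) := by omega
    have e3 : ((q : ℤ) + i - r) = ((q + i - r : ℕ) : ℤ) := by omega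
    rw [trm, e1, e2, e3]
    simp only [dpw_nat]
    rw [div_mul_div_comm, div_mul_div_comm, div_mul_div_comm]
    congr 1
    push_cast
    ring
  · intro i hi
    simp only [Finset.mem_filter, Finset.mem_range] at hi ⊢
    omega
  · intro i _ hi
    simp only [Finset.mem_filter, Finset.mem_range] at hi
    have : (p : ℤ) - i < 0 ∨ (r : ℤ) - i < 0 ∨ (q : ℤ) + i - r < 0 := by omega
    rcases this with h | h | h <;> simp [trm, dpw_neg _ _ h]

lemma key (p : ℕ) (q r : ℤ) (a b c d : ℂ) (hdet : a * d - b * c = 1) :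
    ((p : ℂ) + q + 1) * (a * ∑ i ∈ Finset.range (p + 1), trm p q r a b c d i) =
      ((p : ℂ) + 1) * (r + 1) *
        ∑ i ∈ Finset.range (p + 2), trm (p + 1) q (r + 1) a b c d i +
      ∑ i ∈ Finset.range (p + 1), trm p (q - 1) r a b c d i := by
  have hA : a * ∑ i ∈ Finset.range (p + 1), trm p q r a b c d i =
      ∑ i ∈ Finset.range (p + 2), (i : ℂ) * trm (p + 1) q (r + 1) a b c d i := by
    rw [Finset.sum_range_succ' _ (p + 1), Finset.mul_sum]
    simp only [Nat.cast_zero, zero_mul, add_zero]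
    refine Finset.sum_congr rfl fun i _ => ?_
    have h1 := mul_dpw a i ((i + 1 : ℕ) : ℤ) (by push_cast; rfl)
    simp only [trm]
    rw [show ((p : ℤ) + 1 - ((i + 1 : ℕ) : ℤ)) = p - i by push_cast; ring,
      show (r + 1 - ((i + 1 : ℕ) : ℤ)) = r - i by push_cast; ring,
      show (q + ((i + 1 : ℕ) : ℤ) - (r + 1)) = q + i - r by push_cast; ring]
    rw [Int.cast_natCast] at h1
    linear_combination (dpw b (p - i) * dpw c (r - i) * dpw d (q + i - r)) * h1
  have hB : a * d * ∑ i ∈ Finset.range (p + 1), trm p (q - 1) r a b c d i =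
      ∑ i ∈ Finset.range (p + 2), (i : ℂ) * (q + i - r - 1) *
        trm (p + 1) q (r + 1) a b c d i := by
    rw [Finset.sum_range_succ' _ (p + 1), Finset.mul_sum]
    simp only [Nat.cast_zero, zero_mul, add_zero]
    refine Finset.sum_congr rfl fun i _ => ?_
    have h1 := mul_dpw a i ((i + 1 : ℕ) : ℤ) (by push_cast; rfl)
    have h2 := mul_dpw d (q - 1 + i - r) (q + i - r) (by ring)
    simp only [trm]
    rw [show ((p : ℤ) + 1 - ((i + 1 : ℕ) : ℤ)) = p - i by push_cast; ring,
      show (r + 1 - ((i + 1 : ℕ) : ℤ)) = r - i by push_cast; ring,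
      show (q + ((i + 1 : ℕ) : ℤ) - (r + 1)) = q + i - r by push_cast; ring]
    rw [Int.cast_natCast] at h1
    push_cast at h2
    rw [show a * d * (dpw a i * dpw b (p - i) * dpw c (r - i) * dpw d (q - 1 + i - r)) =
      (a * dpw a i) * dpw b (p - i) * dpw c (r - i) * (d * dpw d (q - 1 + i - r)) by ring,
      h1, h2]
    push_cast
    ring
  have hC : b * c * ∑ i ∈ Finset.range (p + 1), trm p (q - 1) r a b c d i =
      ∑ i ∈ Finset.range (p + 2), ((p : ℂ) + 1 - i) * (r + 1 - i) *
        trm (p + 1) q (r + 1) a b c d i := by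
    rw [Finset.sum_range_succ _ (p + 1), Finset.mul_sum]
    rw [show ((p : ℂ) + 1 - ((p + 1 : ℕ) : ℂ)) = 0 by push_cast; ring]
    simp only [zero_mul, add_zero]
    refine Finset.sum_congr rfl fun i _ => ?_
    have h1 := mul_dpw b (p - i) (p + 1 - i) (by ring)
    have h2 := mul_dpw c (r - i) (r + 1 - i) (by ring)
    simp only [trm]
    rw [show (q + (i : ℤ) - (r + 1)) = q - 1 + i - r by ring]
    push_cast at h1 h2
    rw [show b * c * (dpw a i * dpw b (p - i) * dpw c (r - i) * dpw d (q - 1 + i - r)) =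
      dpw a i * (b * dpw b (p - i)) * (c * dpw c (r - i)) * dpw d (q - 1 + i - r) by ring,
      h1, h2]
    ring
  have hD : ∑ i ∈ Finset.range (p + 1), trm p (q - 1) r a b c d i =
      a * d * ∑ i ∈ Finset.range (p + 1), trm p (q - 1) r a b c d i -
      b * c * ∑ i ∈ Finset.range (p + 1), trm p (q - 1) r a b c d i := by
    rw [← sub_mul, hdet, one_mul]
  rw [hD, hB, hC, hA, Finset.mul_sum, Finset.mul_sum, ← Finset.sum_sub_distrib,
    ← Finset.sum_add_distrib]
  refine Finset.sum_congr rfl fun i _ => ?_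
  ring

/-- For `p + q = r + s` and `ad - bc = 1`:
`a · F_{p,q,r,s} = (√((p+1)(r+1))/(p+q+1)) F_{p+1,q,r+1,s}
  + (√(qs)/(p+q+1)) F_{p,q-1,r,s-1}`
(the last term vanishing when `q = 0` or `s = 0` since its coefficient is `0`). -/
theorem Felt_mul_a (p q r s : ℕ) (h : p + q = r + s) (a b c d : ℂ)
    (hdet : a * d - b * c = 1) :
    a * Felt p q r s a b c d =
      (((Real.sqrt (((p + 1) * (r + 1) : ℕ)) : ℝ) : ℂ) / ((p + q + 1 : ℕ) : ℂ)) *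
          Felt (p + 1) q (r + 1) s a b c d +
        (((Real.sqrt ((q * s : ℕ)) : ℝ) : ℂ) / ((p + q + 1 : ℕ) : ℂ)) *
          Felt p (q - 1) r (s - 1) a b c d := by
  have hk := key p q r a b c d hdet
  unfold Felt
  rw [sum_bridge p q r (p + 1) (by omega), sum_bridge (p + 1) q (r + 1) (p + 2) (by omega),
    sum_bridge p (q - 1) r (p + 1) (by omega)]
  have hN : ((p + q + 1 : ℕ) : ℂ) ≠ 0 := by exact_mod_cast (p + q).succ_ne_zero
  have s1 : Real.sqrt (((p + 1) * (r + 1) : ℕ)) *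
      Real.sqrt (((p + 1).factorial * q.factorial * (r + 1).factorial * s.factorial : ℕ)) =
      ((p : ℝ) + 1) * (r + 1) *
        Real.sqrt ((p.factorial * q.factorial * r.factorial * s.factorial : ℕ)) := by
    rw [← Real.sqrt_mul (by positivity)]
    rw [← Real.sqrt_sq (show 0 ≤ ((p : ℝ) + 1) * (r + 1) by positivity),
      ← Real.sqrt_mul (by positivity)]
    congr 1
    simp only [Nat.factorial_succ]
    push_cast
    ring
  have s2 : ((Real.sqrt ((q * s : ℕ)) : ℝ) : ℂ) *
      (((Real.sqrt ((p.factorial * (q - 1).factorial * r.factorial * (s - 1).factorial : ℕ)) : ℝ) : ℂ)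
        * ∑ i ∈ Finset.range (p + 1), trm p ((q - 1 : ℕ) : ℤ) r a b c d i) =
      ((Real.sqrt ((p.factorial * q.factorial * r.factorial * s.factorial : ℕ)) : ℝ) : ℂ) *
        ∑ i ∈ Finset.range (p + 1), trm p ((q : ℤ) - 1) r a b c d i := by
    by_cases hqs : q = 0 ∨ s = 0
    · have h0 : ∑ i ∈ Finset.range (p + 1), trm p ((q : ℤ) - 1) r a b c d i = 0 := by
        apply Finset.sum_eq_zero
        intro i _
        have : (p : ℤ) - i < 0 ∨ (r : ℤ) - i < 0 ∨ (q : ℤ) - 1 + i - r < 0 := by omega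
        rcases this with h | h | h <;> simp [trm, dpw_neg _ _ h]
      have h1 : q * s = 0 := by simpa using hqs
      rw [h0, h1]; simp
    · obtain ⟨q, rfl⟩ : ∃ k, q = k + 1 := ⟨q - 1, by omega⟩
      obtain ⟨s, rfl⟩ : ∃ k, s = k + 1 := ⟨s - 1, by omega⟩
      rw [← mul_assoc, ← Complex.ofReal_mul, ← Real.sqrt_mul (by positivity)]
      congr 3
      · congr 1
        simp only [Nat.factorial_succ, Nat.add_sub_cancel]
        push_cast
        ring
      · simp
  have s1' := congrArg (fun x : ℝ => (x : ℂ)) s1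
  simp only [Complex.ofReal_mul, Complex.ofReal_add, Complex.ofReal_natCast,
    Complex.ofReal_one] at s1'
  rw [div_mul_eq_mul_div, div_mul_eq_mul_div, s2, ← mul_assoc, ← mul_assoc, s1', ← add_div,
    eq_div_iff hN]
  push_cast at hk ⊢
  linear_combination
    ((Real.sqrt ((p.factorial * q.factorial * r.factorial * s.factorial)) : ℝ) : ℂ) * hk
end
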